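/- arXiv:2411.19316 — 3 statements merged into one kernel-verified Lean document; each statement's English description precedes it below -/
import Mathlib

section
/- Let Ĉ be a finite connected simple graph with distinct vertices v₁ and v₂ such that v₁ has exactly one neighbour, w. Let H be the unique function on the vertices of Ĉ that is harmonic at every vertex outside {v₁, v₂} and satisfies H(v₁) = 1 and H(v₂) = 0. Let D be the graph distance from v₁ to v₂ and let μ be the number of edges of Ĉ. Then H(w) ≤ 1 − 1/D; consequently H(w) ≤ 1 − 1/μ, and H(w) = 1 − 1/μ holds if and only if Ĉ is a path whose two endpoints are v₁ and v₂. -/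
open Classical in
/-- A real valued function on the vertices of a simple graph is harmonic at a
vertex `v` if `v` has at least one neighbour and the value at `v` is the average of
the values over the neighbours of `v`. -/
def HarmonicAt {V : Type*} [Fintype V] (G : SimpleGraph V) (H : V → ℝ) (v : V) : Prop :=
  0 < (Finset.univ.filter (G.Adj v)).card ∧
    H v = (1 / ((Finset.univ.filter (G.Adj v)).card : ℝ)) *
      ∑ u ∈ Finset.univ.filter (G.Adj v), H u

/-- `G` is a path graph whose two endpoints are `v₁` and `v₂`:  there is a path from
`v₁` to `v₂` passing through every vertex and using every edge of `G`. -/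
def IsPathGraphFromTo {V : Type*} (G : SimpleGraph V) (v₁ v₂ : V) : Prop :=
  ∃ p : G.Walk v₁ v₂, p.IsPath ∧ (∀ v, v ∈ p.support) ∧ ∀ e ∈ G.edgeSet, e ∈ p.edges

open Finset

/-- The product of the increments of `F` and `K` along an unordered pair. -/
def edgeForm {V : Type*} (F K : V → ℝ) : Sym2 V → ℝ :=
  Sym2.lift ⟨fun u v => (F u - F v) * (K u - K v), fun u v => by ring⟩

lemma edgeForm_mk {V : Type*} (F K : V → ℝ) (u v : V) :
    edgeForm F K s(u, v) = (F u - F v) * (K u - K v) := rfl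

lemma edgeForm_self_nonneg {V : Type*} (F : V → ℝ) (e : Sym2 V) : 0 ≤ edgeForm F F e := by
  induction e with
  | _ u v => exact mul_self_nonneg _

open Classical in
lemma sum_dart_eq_sum_neighbors {V : Type*} [Fintype V] (G : SimpleGraph V) (f : V → V → ℝ) :
    ∑ d : G.Dart, f d.fst d.snd = ∑ u, ∑ v ∈ univ.filter (G.Adj u), f u v := by
  rw [Finset.sum_sigma']
  refine Finset.sum_bij' (fun d _ => ⟨d.fst, d.snd⟩)
    (fun x hx => ⟨(x.1, x.2), by simpa using hx⟩) ?_ ?_ ?_ ?_ ?_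
  · intro d _
    simp
  all_goals simp

open Classical in
lemma sum_dart_edge {V : Type*} [Fintype V] (G : SimpleGraph V) (q : Sym2 V → ℝ) :
    ∑ d : G.Dart, q d.edge = 2 * ∑ e ∈ G.edgeFinset, q e := by
  rw [← Finset.sum_fiberwise_of_maps_to (s := univ) (t := G.edgeFinset)
    (g := fun d : G.Dart => d.edge) (fun d _ => by simp), Finset.mul_sum]
  refine Finset.sum_congr rfl fun e he => ?_
  rw [Finset.sum_congr rfl (g := fun _ => q e) (by simp +contextual), Finset.sum_const,
    G.dart_edge_fiber_card e (by simpa using he)]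
  simp

open Classical in
/-- Discrete Green formula. -/
lemma sum_edgeForm {V : Type*} [Fintype V] (G : SimpleGraph V) (F K : V → ℝ) :
    ∑ e ∈ G.edgeFinset, edgeForm F K e =
      ∑ u, F u * ∑ v ∈ univ.filter (G.Adj u), (K u - K v) := by
  have h := sum_dart_edge G (edgeForm F K)
  have hd : ∀ d : G.Dart, edgeForm F K d.edge =
      F d.fst * (K d.fst - K d.snd) + F d.snd * (K d.snd - K d.fst) := fun d => by
    change (F d.fst - F d.snd) * (K d.fst - K d.snd) = _
    ring
  have hs : ∑ d : G.Dart, F d.snd * (K d.snd - K d.fst) =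
      ∑ d : G.Dart, F d.fst * (K d.fst - K d.snd) :=
    Fintype.sum_equiv (Function.Involutive.toPerm _ SimpleGraph.Dart.symm_involutive) _ _
      fun d => rfl
  have hn := sum_dart_eq_sum_neighbors G fun u v => F u * (K u - K v)
  simp only [hd, Finset.sum_add_distrib, hs, hn] at h
  simp only [Finset.mul_sum]
  linarith

open Classical in
lemma HarmonicAt.sum_sub_eq_zero {V : Type*} [Fintype V] {G : SimpleGraph V} {H : V → ℝ} {v : V}
    (h : HarmonicAt G H v) : ∑ u ∈ univ.filter (G.Adj v), (H v - H u) = 0 := by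
  obtain ⟨hpos, heq⟩ := h
  have hpos' : ((univ.filter (G.Adj v)).card : ℝ) ≠ 0 := by exact_mod_cast hpos.ne'
  rw [Finset.sum_sub_distrib, Finset.sum_const, nsmul_eq_mul, heq]
  field_simp
  ring

/-- Young's inequality summed along the edges of a walk. -/
lemma two_mul_sub_le_walk_sum {V : Type*} {G : SimpleGraph V} (F : V → ℝ) (t : ℝ) {a b : V}
    (p : G.Walk a b) :
    2 * t * (F a - F b) ≤ p.length * t ^ 2 + (p.edges.map (edgeForm F F)).sum := by
  induction p with
  | nil => simp
  | @cons u v w h p ih =>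
    simp only [SimpleGraph.Walk.length_cons, SimpleGraph.Walk.edges_cons, List.map_cons,
      List.sum_cons, edgeForm_mk]
    push_cast
    nlinarith [sq_nonneg (t - (F u - F v))]

open Classical in
lemma two_mul_sub_le_of_isTrail {V : Type*} [Fintype V] {G : SimpleGraph V} (F : V → ℝ) (t : ℝ)
    {a b : V} {p : G.Walk a b} (hp : p.IsTrail) :
    2 * t * (F a - F b) ≤ p.length * t ^ 2 + ∑ e ∈ G.edgeFinset, edgeForm F F e := by
  refine (two_mul_sub_le_walk_sum F t p).trans ?_
  rw [← List.sum_toFinset _ hp.edges_nodup]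
  refine add_le_add_right (Finset.sum_le_sum_of_subset_of_nonneg (fun e he => ?_)
    fun e _ _ => edgeForm_self_nonneg F e) _
  simpa using p.edges_subset_edgeSet (by simpa using he)

/-- The position function of a path changes by one along every edge of the path. -/
lemma SimpleGraph.Walk.IsPath.exists_index {V : Type*} {G : SimpleGraph V} {a b : V}
    {p : G.Walk a b} (hp : p.IsPath) :
    ∃ idx : V → ℝ, idx a = 0 ∧ idx b = p.length ∧
      ∀ e ∈ p.edges, edgeForm idx idx e = 1 := by
  classical
  have hidx : ∀ i ≤ p.length, p.support.idxOf (p.getVert i) = i := fun i hi => by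
    rw [p.getVert_eq_support_getElem hi]
    exact hp.support_nodup.idxOf_getElem _ _
  refine ⟨fun v => p.support.idxOf v, ?_, ?_, ?_⟩
  · have := hidx 0 (Nat.zero_le _)
    simp only [SimpleGraph.Walk.getVert_zero] at this
    simp [this]
  · have := hidx p.length le_rfl
    simp only [SimpleGraph.Walk.getVert_length] at this
    simp [this]
  · intro e he
    induction e with
    | _ u v =>
      rw [edgeForm_mk]
      obtain ⟨i, hlt, hi⟩ := p.mk_mem_edges_iff_exists.1 he
      have h0 := hidx i hlt.le
      have h1 := hidx (i + 1) hlt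
      rcases Sym2.eq_iff.1 hi with ⟨rfl, rfl⟩ | ⟨rfl, rfl⟩ <;> rw [h0, h1] <;> push_cast <;> ring

open Classical in
/-- For a function that is harmonic off `v₁, v₂`, pairing with any function that is `1` at `v₁`
and `0` at `v₂` gives the current leaving `v₁`. -/
lemma sum_edgeForm_of_harmonic {V : Type*} [Fintype V] {G : SimpleGraph V} {v₁ v₂ w : V}
    (hw : ∀ x, G.Adj v₁ x ↔ x = w) {H : V → ℝ}
    (hharm : ∀ v, v ∉ ({v₁, v₂} : Set V) → HarmonicAt G H v)
    {F : V → ℝ} (hF1 : F v₁ = 1) (hF2 : F v₂ = 0) :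
    ∑ e ∈ G.edgeFinset, edgeForm F H e = H v₁ - H w := by
  rw [sum_edgeForm, Finset.sum_eq_single v₁]
  · have hnbr : univ.filter (G.Adj v₁) = {w} := by
      ext x
      simp [hw]
    rw [hnbr, hF1, Finset.sum_singleton, one_mul]
  · intro u _ hu
    by_cases h2 : u = v₂
    · simp [h2, hF2]
    · rw [(hharm u (by simp [hu, h2])).sum_sub_eq_zero, mul_zero]
  · simp

theorem statement3 {V : Type*} [Fintype V] (G : SimpleGraph V) (hG : G.Connected)
    (v₁ v₂ w : V) (hne : v₁ ≠ v₂)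
    (hw : ∀ x, G.Adj v₁ x ↔ x = w)
    (H : V → ℝ)
    (hharm : ∀ v, v ∉ ({v₁, v₂} : Set V) → HarmonicAt G H v)
    (h1 : H v₁ = 1) (h2 : H v₂ = 0)
    (hH : ∀ H' : V → ℝ, (∀ v, v ∉ ({v₁, v₂} : Set V) → HarmonicAt G H' v) →
      H' v₁ = 1 → H' v₂ = 0 → H' = H)
    (D : ℕ) (hD : D = G.dist v₁ v₂)
    (μ : ℕ) (hμ : μ = Nat.card G.edgeSet) :
    H w ≤ 1 - 1 / (D : ℝ) ∧ H w ≤ 1 - 1 / (μ : ℝ) ∧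
      (H w = 1 - 1 / (μ : ℝ) ↔ IsPathGraphFromTo G v₁ v₂) := by
  classical
  have hμ' : μ = #G.edgeFinset := by
    rw [hμ, Nat.card_eq_fintype_card, SimpleGraph.edgeFinset_card]
  obtain ⟨p, hp, hpD⟩ := hG.exists_path_of_dist v₁ v₂
  rw [← hD] at hpD
  have hD0 : 0 < D := hD ▸ hG.pos_dist_of_ne hne
  have hDμ : D ≤ μ := by
    rw [← hpD, hμ']
    exact hp.isTrail.length_le_card_edgeFinset
  have hD0' : (0 : ℝ) < D := by exact_mod_cast hD0
  have hμ0 : (0 : ℝ) < μ := by exact_mod_cast hD0.trans_le hDμ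
  have hDμ' : (D : ℝ) ≤ μ := by exact_mod_cast hDμ
  have henergy := sum_edgeForm_of_harmonic hw hharm h1 h2
  have hbound : 1 / (D : ℝ) ≤ 1 - H w := by
    have h := two_mul_sub_le_of_isTrail H (1 / (D : ℝ)) hp.isTrail
    rw [henergy, hpD, h1, h2] at h
    have : (D : ℝ) * (1 / (D : ℝ)) ^ 2 = 1 / D := by field_simp
    linarith
  have hinv : 1 / (μ : ℝ) ≤ 1 / D := one_div_le_one_div_of_le hD0' hDμ'
  refine ⟨by linarith, by linarith, fun heq => ?_, ?_⟩
  · have hμD : μ = D := by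
      have : (μ : ℝ) ≤ D := (one_div_le_one_div hD0' hμ0).1 (by linarith)
      exact le_antisymm (by exact_mod_cast this) hDμ
    have hsub : p.edges.toFinset ⊆ G.edgeFinset := fun e he => by
      simpa using p.edges_subset_edgeSet (by simpa using he)
    have hall : p.edges.toFinset = G.edgeFinset := Finset.eq_of_subset_of_card_le hsub <| by
      rw [List.toFinset_card_of_nodup hp.isTrail.edges_nodup, p.length_edges, hpD, ← hμ', hμD]
    have hedge : ∀ e ∈ G.edgeSet, e ∈ p.edges := fun e he => by
      rw [← List.mem_toFinset, hall]
      simpa using he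
    refine ⟨p, hp, fun v => ?_, hedge⟩
    have : Nontrivial V := ⟨v₁, v₂, hne⟩
    obtain ⟨u, hu⟩ := hG.preconnected.exists_adj_of_nontrivial v
    exact p.fst_mem_support_of_mem_edges (hedge s(v, u) hu)
  · rintro ⟨r, hr, -, hedge⟩
    obtain ⟨idx, ha, hb, hstep⟩ := hr.exists_index
    have hlen : r.length = μ := by
      have : r.edges.toFinset = G.edgeFinset := by
        ext e
        simpa using ⟨fun he => r.edges_subset_edgeSet he, hedge e⟩
      rw [hμ', ← this, List.toFinset_card_of_nodup hr.isTrail.edges_nodup, r.length_edges]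
    set F : V → ℝ := fun v => 1 - idx v / μ with hFdef
    have hF1 : F v₁ = 1 := by simp [hFdef, ha]
    have hF2 : F v₂ = 0 := by simp [hFdef, hb, hlen, hμ0.ne']
    have hcross := sum_edgeForm_of_harmonic hw hharm hF1 hF2
    have hFF : ∑ e ∈ G.edgeFinset, edgeForm F F e = 1 / μ := by
      have : ∀ e ∈ G.edgeFinset, edgeForm F F e = 1 / (μ : ℝ) ^ 2 := fun e he => by
        have hs := hstep e (hedge e (by simpa using he))
        induction e with
        | _ u v =>
          rw [edgeForm_mk] at hs ⊢
          rw [← hs]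
          simp only [hFdef]
          field_simp
          ring
      rw [Finset.sum_congr rfl this, Finset.sum_const, ← hμ', nsmul_eq_mul]
      field_simp
    have hdiff : 0 ≤ ∑ e ∈ G.edgeFinset,
        (edgeForm F F e - 2 * edgeForm F H e + edgeForm H H e) :=
      Finset.sum_nonneg fun e _ => by
        induction e with
        | _ u v =>
          simp only [edgeForm_mk]
          nlinarith [sq_nonneg ((F u - F v) - (H u - H v))]
    rw [Finset.sum_add_distrib, Finset.sum_sub_distrib, ← Finset.mul_sum, hFF, hcross,
      henergy] at hdiff
    linarith
end

section
/- Let G be a finite connected simple graph with distinct vertices v₁, v₂ such that v₁ has exactly one neighbour, w. Let H be a function on the vertices of G that is harmonic at every vertex outside {v₁, v₂}, with H(v₁) = 1 and H(v₂) = 0. Then H(v) ≤ H(w) for every vertex v ≠ v₁. -/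
theorem HarmonicAt.neg {V : Type*} [Fintype V] {G : SimpleGraph V} {H : V → ℝ} {v : V}
    (h : HarmonicAt G H v) : HarmonicAt G (fun x => -H x) v := by
  refine ⟨h.1, ?_⟩
  have h' := h.2
  rw [Finset.sum_neg_distrib, mul_neg, ← h']

/-- A harmonic function with a local maximum at `v` is constant on the neighbours of `v`. -/
theorem HarmonicAt.eq_of_forall_adj_le {V : Type*} [Fintype V] {G : SimpleGraph V} {H : V → ℝ}
    {v : V} (h : HarmonicAt G H v) (hmax : ∀ u, G.Adj v u → H u ≤ H v) {u : V}
    (hu : G.Adj v u) : H u = H v := by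
  classical
  obtain ⟨hpos, heq⟩ := h
  have hpos' : (0 : ℝ) < ((Finset.univ.filter (G.Adj v)).card : ℝ) := by exact_mod_cast hpos
  have hsum : ∑ x ∈ Finset.univ.filter (G.Adj v), H x =
      ∑ _x ∈ Finset.univ.filter (G.Adj v), H v := by
    rw [Finset.sum_const, nsmul_eq_mul]
    field_simp at heq
    convert heq.symm using 1
    ring
  exact (Finset.sum_eq_sum_iff_of_le fun x hx => hmax x (Finset.mem_filter.1 hx).2).1 hsum u
    (by simpa using hu)

/-- A property that spreads to neighbours from every vertex outside `S` and holds somewhere in a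
connected graph must hold at a vertex of `S`, provided `S` is nonempty. -/
theorem SimpleGraph.Connected.exists_mem_of_spreads {V : Type*} {G : SimpleGraph V}
    (hG : G.Connected) {S : Set V} {s : V} (hs : s ∈ S) {P : V → Prop}
    (hP : ∀ v, v ∉ S → P v → ∀ u, G.Adj v u → P u) {v : V} (hv : P v) : ∃ x ∈ S, P x := by
  obtain ⟨p⟩ := hG.preconnected v s
  induction p with
  | nil => exact ⟨_, hs, hv⟩
  | @cons a b c hadj p ih =>
    by_cases ha : a ∈ S
    · exact ⟨a, ha, hv⟩
    · exact ih hs (hP a ha hv b hadj)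

/-- The maximum principle on a finite connected graph. -/
theorem exists_mem_forall_le_of_harmonicAt {V : Type*} [Fintype V] {G : SimpleGraph V}
    (hG : G.Connected) {S : Set V} {s : V} (hs : s ∈ S) {H : V → ℝ}
    (hH : ∀ v, v ∉ S → HarmonicAt G H v) : ∃ x ∈ S, ∀ v, H v ≤ H x := by
  have : Nonempty V := ⟨s⟩
  obtain ⟨m, hm⟩ := Finite.exists_max H
  refine hG.exists_mem_of_spreads hs (fun v hv hmax u hu x => ?_) hm
  rw [(hH v hv).eq_of_forall_adj_le (fun y _ => hmax y) hu]
  exact hmax x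

theorem statement5 {V : Type*} [Fintype V] (G : SimpleGraph V) (hG : G.Connected)
    (v₁ v₂ w : V) (hne : v₁ ≠ v₂)
    (hw : ∀ x, G.Adj v₁ x ↔ x = w)
    (H : V → ℝ)
    (hharm : ∀ v, v ∉ ({v₁, v₂} : Set V) → HarmonicAt G H v)
    (h1 : H v₁ = 1) (h2 : H v₂ = 0) :
    ∀ v, v ≠ v₁ → H v ≤ H w := by
  have hnonneg : 0 ≤ H w := by
    obtain ⟨x, hx, hmin⟩ := exists_mem_forall_le_of_harmonicAt hG
      (show v₁ ∈ ({v₁, v₂} : Set V) by simp) (H := fun x => -H x)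
      (fun v hv => (hharm v hv).neg)
    have hwx := hmin w
    rcases hx with rfl | rfl
    · linarith
    · linarith
  obtain ⟨m, hm, hmax⟩ := Set.exists_max_image {v | v ≠ v₁} H (Set.toFinite _) ⟨v₂, hne.symm⟩
  obtain ⟨x, hx, -, hle⟩ := hG.exists_mem_of_spreads
    (S := {w, v₂}) (s := w) (by simp) (P := fun x => x ≠ v₁ ∧ ∀ v, v ≠ v₁ → H v ≤ H x)
    (by
      rintro v hv ⟨hv1, hle⟩ u hu
      simp only [Set.mem_insert_iff, Set.mem_singleton_iff, not_or] at hv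
      have hadj : ∀ y, G.Adj v y → y ≠ v₁ := by
        rintro y hy rfl
        exact hv.1 ((hw v).1 hy.symm)
      refine ⟨hadj u hu, ?_⟩
      rw [(hharm v (by simp [hv1, hv.2])).eq_of_forall_adj_le (fun y hy => hle y (hadj y hy)) hu]
      exact hle)
    (v := m) ⟨hm, hmax⟩
  intro v hv
  have hvx := hle v hv
  rcases hx with rfl | rfl
  · exact hvx
  · linarith
end

section
/- Let P, Q ∈ ℂ[X] be nonzero polynomials having no common real root in the interval (1, ∞), let N be a positive integer, let ρ > 1 be a real number, and let f, d : ℝ → ℂ be functions such that: d takes real values on (1, ρ) with d(z) > z for all z ∈ (1, ρ); every real y ∈ (1, ∞) equals d(z) for some z ∈ (1, ρ); f(z) ≠ 0 for all z ∈ (1, ρ); and f(z)^N·P(d(z))·Q(z) = P(z)·Q(d(z)) for all z ∈ (1, ρ). Then neither P nor Q has a real root in (1, ∞). -/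
/-- A nonzero complex polynomial has no real root above `a` if every such root admits a strictly
smaller one above `a`. -/
theorem eval_ne_zero_of_descending_real_roots {R : Polynomial ℂ} (hR : R ≠ 0) {a : ℝ}
    (h : ∀ y : ℝ, a < y → R.eval (y : ℂ) = 0 → ∃ z : ℝ, a < z ∧ z < y ∧ R.eval (z : ℂ) = 0)
    {x : ℝ} (hx : a < x) : R.eval (x : ℂ) ≠ 0 := by
  intro hx0
  have hfin : {y : ℝ | a < y ∧ R.eval (y : ℂ) = 0}.Finite :=
    ((Polynomial.finite_setOfPred_isRoot hR).preimage Complex.ofReal_injective.injOn).subset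
      fun y hy => hy.2
  obtain ⟨m, hm, hmin⟩ := Set.exists_min_image _ id hfin ⟨x, hx, hx0⟩
  obtain ⟨z, haz, hzm, hz⟩ := h m hm.1 hm.2
  exact absurd (hmin z ⟨haz, hz⟩) (not_le.mpr hzm)

theorem statement10 (P Q : Polynomial ℂ) (hP : P ≠ 0) (hQ : Q ≠ 0)
    (hnocommon : ∀ x : ℝ, 1 < x → ¬(P.eval (x : ℂ) = 0 ∧ Q.eval (x : ℂ) = 0))
    (N : ℕ) (hN : 0 < N) (ρ : ℝ) (hρ : 1 < ρ)
    (f d : ℝ → ℂ)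
    (hdreal : ∀ z ∈ Set.Ioo 1 ρ, ∃ r : ℝ, d z = (r : ℂ) ∧ z < r)
    (hdsurj : ∀ y : ℝ, 1 < y → ∃ z ∈ Set.Ioo 1 ρ, d z = (y : ℂ))
    (hf : ∀ z ∈ Set.Ioo 1 ρ, f z ≠ 0)
    (heq : ∀ z ∈ Set.Ioo 1 ρ,
      (f z) ^ N * P.eval (d z) * Q.eval (z : ℂ) = P.eval (z : ℂ) * Q.eval (d z)) :
    ∀ x : ℝ, 1 < x → P.eval (x : ℂ) ≠ 0 ∧ Q.eval (x : ℂ) ≠ 0 := by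
  have preimage_lt : ∀ y : ℝ, 1 < y → ∃ z ∈ Set.Ioo 1 ρ, d z = (y : ℂ) ∧ z < y := by
    intro y hy
    obtain ⟨z, hz, hdz⟩ := hdsurj y hy
    obtain ⟨r, hr, hzr⟩ := hdreal z hz
    obtain rfl : r = y := Complex.ofReal_injective (hr.symm.trans hdz)
    exact ⟨z, hz, hdz, hzr⟩
  intro x hx
  constructor
  · refine eval_ne_zero_of_descending_real_roots hP (fun y hy hy0 => ?_) hx
    obtain ⟨z, hz, hdz, hzy⟩ := preimage_lt y hy
    have hQ_y : Q.eval (y : ℂ) ≠ 0 := fun hQy => hnocommon y hy ⟨hy0, hQy⟩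
    have key := heq z hz
    rw [hdz, hy0, mul_zero, zero_mul] at key
    exact ⟨z, hz.1, hzy, (mul_eq_zero.mp key.symm).resolve_right hQ_y⟩
  · refine eval_ne_zero_of_descending_real_roots hQ (fun y hy hy0 => ?_) hx
    obtain ⟨z, hz, hdz, hzy⟩ := preimage_lt y hy
    have hP_y : P.eval (y : ℂ) ≠ 0 := fun hPy => hnocommon y hy ⟨hPy, hy0⟩
    have key := heq z hz
    rw [hdz, hy0, mul_zero] at key
    exact ⟨z, hz.1, hzy,
      (mul_eq_zero.mp key).resolve_left (mul_ne_zero (pow_ne_zero N (hf z hz)) hP_y)⟩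
end
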